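/- Let X be a finite connected vertex-transitive graph containing a 3-caret of branch length R at a vertex v₀. Then the ball of radius R around v₀ satisfies |B(v₀, R)| ≥ R^{log₃4}. -/

import Mathlib

/-- A 3-caret of branch length `R` at `v₀`: three geodesic paths of length `R`
starting at `v₀` (so `d(v₀, γᵢ(k)) = k` for `k ≤ R`) which are pairwise
separated: `d(γᵢ(kᵢ), γⱼ(kⱼ)) ≥ max(kᵢ, kⱼ)` for `i ≠ j`. -/
def IsThreeCaret {V : Type*} (Γ : SimpleGraph V) (R : ℕ) (v₀ : V) : Prop :=
  ∃ γ : Fin 3 → ℕ → V,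
    (∀ i, γ i 0 = v₀) ∧
    (∀ i, ∀ k < R, Γ.Adj (γ i k) (γ i (k + 1))) ∧
    (∀ i, ∀ k ≤ R, Γ.dist v₀ (γ i k) = k) ∧
    (∀ i j, i ≠ j → ∀ k ≤ R, ∀ k' ≤ R, max k k' ≤ Γ.dist (γ i k) (γ j k'))

theorem caret_iso_dist_le {V : Type*} (Γ : SimpleGraph V) (hconn : Γ.Connected) (φ : Γ ≃g Γ)
    (u v : V) : Γ.dist (φ u) (φ v) ≤ Γ.dist u v := by
  obtain ⟨p, hp⟩ := hconn.exists_walk_length_eq_dist u v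
  have h := SimpleGraph.dist_le (p.map φ.toHom)
  rw [SimpleGraph.Walk.length_map, hp] at h
  exact h

theorem caret_mono {V : Type*} {Γ : SimpleGraph V} {R r : ℕ} {v₀ : V} (hr : r ≤ R)
    (h : IsThreeCaret Γ R v₀) : IsThreeCaret Γ r v₀ := by
  obtain ⟨γ, h0, h1, h2, h3⟩ := h
  exact ⟨γ, h0, fun i k hk => h1 i k (by omega), fun i k hk => h2 i k (by omega),
    fun i j hij k hk k' hk' => h3 i j hij k (by omega) k' (by omega)⟩

theorem caret_linear {V : Type*} [Fintype V] (Γ : SimpleGraph V)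
    (R : ℕ) (v₀ : V) (hcaret : IsThreeCaret Γ R v₀) :
    3 * R + 1 ≤ ({v | Γ.dist v₀ v ≤ R}).ncard := by
  obtain ⟨γ, h0, h1, h2, h3⟩ := hcaret
  let f : Option (Fin 3 × Fin R) → {v | Γ.dist v₀ v ≤ R} := fun o =>
    match o with
    | none => ⟨v₀, by simp⟩
    | some (i, k) => ⟨γ i (k + 1), by
        have := h2 i (k + 1) (by omega)
        have := k.2
        simp only [Set.mem_ofPred_eq]; omega⟩
  have hf : Function.Injective f := by
    rintro (_ | ⟨i, k⟩) (_ | ⟨j, l⟩) h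
    · rfl
    · have h' : v₀ = γ j (l + 1) := congrArg Subtype.val h
      have := h2 j (l + 1) (by omega)
      rw [← h'] at this
      simp at this
    · have h' : γ i (k + 1) = v₀ := congrArg Subtype.val h
      have := h2 i (k + 1) (by omega)
      rw [h'] at this
      simp at this
    · have h' : γ i (k + 1) = γ j (l + 1) := congrArg Subtype.val h
      have hk := h2 i (k + 1) (by omega)
      have hl := h2 j (l + 1) (by omega)
      rw [h', hl] at hk
      have hkl : k = l := by ext; omega
      by_cases hij : i = j
      · rw [hij, hkl]
      · have := h3 i j hij (k + 1) (by omega) (l + 1) (by omega)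
        rw [h'] at this
        simp at this
  have := Nat.card_le_card_of_injective f hf
  rw [Nat.card_coe_set_eq] at this
  simp at this
  omega

theorem caret_step {V : Type*} [Fintype V] (Γ : SimpleGraph V)
    (hconn : Γ.Connected)
    (htrans : ∀ u v : V, ∃ φ : Γ ≃g Γ, φ u = v)
    (R r : ℕ) (hr : 3 * r + 1 ≤ R) (v₀ : V) (hcaret : IsThreeCaret Γ R v₀) :
    4 * ({v | Γ.dist v₀ v ≤ r}).ncard ≤ ({v | Γ.dist v₀ v ≤ R}).ncard := by
  obtain ⟨γ, h0, h1, h2, h3⟩ := hcaret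
  let c : Option (Fin 3) → V := fun o => o.elim v₀ (fun i => γ i (2 * r + 1))
  have hc0 : ∀ o, Γ.dist v₀ (c o) ≤ 2 * r + 1 := by
    rintro (_ | i)
    · simp [c]
    · exact (h2 i (2 * r + 1) (by omega)).le
  have hc : ∀ o o', o ≠ o' → 2 * r + 1 ≤ Γ.dist (c o) (c o') := by
    rintro (_ | i) (_ | j) h
    · exact absurd rfl h
    · exact (h2 j (2 * r + 1) (by omega)).ge
    · rw [SimpleGraph.dist_comm]
      exact (h2 i (2 * r + 1) (by omega)).ge
    · have := h3 i j (fun e => h (by rw [e])) (2 * r + 1) (by omega) (2 * r + 1) (by omega)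
      exact (le_max_left _ _).trans this
  choose φ hφ using fun o => htrans v₀ (c o)
  have hd : ∀ o x, Γ.dist (c o) (φ o x) ≤ Γ.dist v₀ x := by
    intro o x
    have := caret_iso_dist_le Γ hconn (φ o) v₀ x
    rwa [hφ] at this
  let f : Option (Fin 3) × {v | Γ.dist v₀ v ≤ r} → {v | Γ.dist v₀ v ≤ R} := fun p =>
    ⟨φ p.1 p.2.1, by
      have a := hd p.1 p.2.1
      have b : Γ.dist v₀ p.2.1 ≤ r := p.2.2
      have d := hc0 p.1
      have e := hconn.dist_triangle (u := v₀) (v := c p.1) (w := φ p.1 p.2.1)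
      simp only [Set.mem_ofPred_eq]; omega⟩
  have hf : Function.Injective f := by
    rintro ⟨o, x, hx⟩ ⟨o', x', hx'⟩ h
    have h' : φ o x = φ o' x' := congrArg Subtype.val h
    have ho : o = o' := by
      by_contra hne
      have a := hd o x
      have a' := hd o' x'
      have b : Γ.dist v₀ x ≤ r := hx
      have b' : Γ.dist v₀ x' ≤ r := hx'
      have d := hc o o' hne
      have e := hconn.dist_triangle (u := c o) (v := φ o x) (w := c o')
      rw [← h', SimpleGraph.dist_comm] at a'
      omega
    subst ho
    have := (φ o).injective h'
    subst this
    rfl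
  have := Nat.card_le_card_of_injective f hf
  rw [Nat.card_prod, Nat.card_coe_set_eq, Nat.card_coe_set_eq] at this
  simpa using this

theorem caret_logb_le : Real.logb 3 4 ≤ 4 / 3 := by
  rw [Real.logb_le_iff_le_rpow (by norm_num) (by norm_num)]
  have h : (4 : ℝ) = ((4 : ℝ) ^ (3 : ℕ)) ^ ((1 : ℝ) / 3) := by
    rw [← Real.rpow_natCast, ← Real.rpow_mul (by norm_num)]; norm_num
  have h2 : (3 : ℝ) ^ ((4 : ℝ) / 3) = ((3 : ℝ) ^ (4 : ℕ)) ^ ((1 : ℝ) / 3) := by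
    rw [← Real.rpow_natCast, ← Real.rpow_mul (by norm_num)]; norm_num
  rw [h2]
  nth_rewrite 1 [h]
  exact Real.rpow_le_rpow (by norm_num) (by norm_num) (by norm_num)

theorem caret_base (x y : ℝ) (hx : 1 ≤ x) (hy : 0 ≤ y) (h : x ^ 4 ≤ y ^ 3) :
    x ^ Real.logb 3 4 ≤ y := by
  refine (Real.rpow_le_rpow_of_exponent_le hx caret_logb_le).trans ?_
  have h1 : y = (y ^ (3 : ℕ)) ^ ((1 : ℝ) / 3) := by
    rw [← Real.rpow_natCast, ← Real.rpow_mul hy]; norm_num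
  have h2 : x ^ ((4 : ℝ) / 3) = (x ^ (4 : ℕ)) ^ ((1 : ℝ) / 3) := by
    rw [← Real.rpow_natCast, ← Real.rpow_mul (by linarith)]; norm_num
  rw [h2, h1]
  exact Real.rpow_le_rpow (by positivity) h (by norm_num)

theorem caret_strong {V : Type*} [Fintype V] (Γ : SimpleGraph V)
    (hconn : Γ.Connected)
    (htrans : ∀ u v : V, ∃ φ : Γ ≃g Γ, φ u = v)
    (v₀ : V) (R : ℕ) (hR : 1 ≤ R) (hcaret : IsThreeCaret Γ R v₀) :
    ((R : ℝ) + 3 / 2) ^ Real.logb 3 4 ≤ (({v | Γ.dist v₀ v ≤ R}).ncard : ℝ) := by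
  induction R using Nat.strong_induction_on with
  | _ R ih =>
  by_cases h : R ≤ 3
  · have hl := caret_linear Γ R v₀ hcaret
    have hl' : (3 * R + 1 : ℝ) ≤ (({v | Γ.dist v₀ v ≤ R}).ncard : ℝ) := by exact_mod_cast hl
    refine le_trans (caret_base _ _ ?_ ?_ ?_) hl'
    · have : (0 : ℝ) ≤ R := by positivity
      linarith
    · positivity
    · interval_cases R <;> norm_num
  · have hs := caret_step Γ hconn htrans R ((R - 1) / 3) (by omega) v₀ hcaret
    have hi := ih ((R - 1) / 3) (by omega) (by omega) (caret_mono (by omega) hcaret)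
    have hs' : (4 : ℝ) * (({v | Γ.dist v₀ v ≤ (R - 1) / 3}).ncard : ℝ)
        ≤ (({v | Γ.dist v₀ v ≤ R}).ncard : ℝ) := by exact_mod_cast hs
    refine le_trans ?_ hs'
    refine le_trans ?_ (mul_le_mul_of_nonneg_left hi (by norm_num))
    have h4 : (4 : ℝ) = 3 ^ Real.logb 3 4 :=
      (Real.rpow_logb (by norm_num) (by norm_num) (by norm_num)).symm
    have hpos : 0 ≤ Real.logb 3 4 := Real.logb_nonneg (by norm_num) (by norm_num)
    have hRr : R ≤ 3 * ((R - 1) / 3) + 3 := by omega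
    generalize (R - 1) / 3 = r at hRr
    have hRr' : (R : ℝ) ≤ 3 * r + 3 := by exact_mod_cast hRr
    calc ((R : ℝ) + 3 / 2) ^ Real.logb 3 4
        ≤ (3 * ((r : ℝ) + 3 / 2)) ^ Real.logb 3 4 :=
          Real.rpow_le_rpow (by positivity) (by linarith) hpos
      _ = 3 ^ Real.logb 3 4 * ((r : ℝ) + 3 / 2) ^ Real.logb 3 4 :=
          Real.mul_rpow (by norm_num) (by positivity)
      _ = 4 * ((r : ℝ) + 3 / 2) ^ Real.logb 3 4 := by rw [← h4]

/-- If a finite connected vertex-transitive graph contains a 3-caret of branch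
length `R` at `v₀`, then `|B(v₀, R)| ≥ R^{log₃ 4}`. -/
theorem ball_card_ge_of_three_caret
    {V : Type*} [Fintype V] (Γ : SimpleGraph V)
    (hconn : Γ.Connected)
    (htrans : ∀ u v : V, ∃ φ : Γ ≃g Γ, φ u = v)
    (R : ℕ) (v₀ : V) (hcaret : IsThreeCaret Γ R v₀) :
    (R : ℝ) ^ Real.logb 3 4 ≤ (({v | Γ.dist v₀ v ≤ R}).ncard : ℝ) := by
  have hpos : 0 < Real.logb 3 4 := Real.logb_pos (by norm_num) (by norm_num)
  rcases Nat.eq_zero_or_pos R with rfl | hR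
  · rw [Nat.cast_zero, Real.zero_rpow hpos.ne']
    positivity
  · exact (Real.rpow_le_rpow (by positivity) (by linarith) hpos.le).trans
      (caret_strong Γ hconn htrans v₀ R hR hcaret)
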